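/- Fix positive integers t ≤ m ≤ n, let X be an m×n matrix of indeterminates over a field 𝔽 of prime characteristic p, let R = 𝔽[X], and let I_t be the ideal generated by the t×t minors of X. Then the F-pure threshold of I_t equals min{ (m−k)(n−k)/(t−k) : k = 0, 1, …, t−1 }. -/

import Mathlib

open MvPolynomial

/-- The bracket power `J^{[q]}`: the ideal generated by the `q`-th powers of the
elements of `J`. -/
noncomputable def bracketPow {R : Type*} [CommRing R] (J : Ideal R) (q : ℕ) : Ideal R :=
  Ideal.span ((fun a => a ^ q) '' (J : Set R))

/-- The homogeneous maximal ideal `𝔪` of a polynomial ring, generated by the variables. -/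
noncomputable def maxIdl (𝔽 : Type*) [Field 𝔽] (σ : Type*) : Ideal (MvPolynomial σ 𝔽) :=
  Ideal.span (Set.range MvPolynomial.X)

/-- `ν_I(q) = max { r ∈ ℕ | I^r ⊄ 𝔪^{[q]} }`. -/
noncomputable def nu {𝔽 σ : Type*} [Field 𝔽] (I : Ideal (MvPolynomial σ 𝔽)) (q : ℕ) : ℕ :=
  sSup {r : ℕ | ¬ I ^ r ≤ bracketPow (maxIdl 𝔽 σ) q}

/-- The generic `m × n` matrix `X`, whose entries are the variables `x_{ij}` of the
polynomial ring `𝔽[X]`. -/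
noncomputable def genMat (𝔽 : Type*) [Field 𝔽] (m n : ℕ) :
    Matrix (Fin m) (Fin n) (MvPolynomial (Fin m × Fin n) 𝔽) :=
  Matrix.of fun i j => MvPolynomial.X (i, j)

/-- `f` is a size `s` minor of the generic `m × n` matrix: the determinant of the submatrix
obtained by choosing `s` rows and `s` columns (in increasing order). -/
def IsMinor (𝔽 : Type*) [Field 𝔽] (m n s : ℕ) (f : MvPolynomial (Fin m × Fin n) 𝔽) : Prop :=
  ∃ (row : Fin s → Fin m) (col : Fin s → Fin n), StrictMono row ∧ StrictMono col ∧
    f = ((genMat 𝔽 m n).submatrix row col).det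

/-- `I_s ⊆ 𝔽[X]`, the ideal generated by the size `s` minors of the generic matrix. -/
noncomputable def minorsIdeal (𝔽 : Type*) [Field 𝔽] (m n s : ℕ) :
    Ideal (MvPolynomial (Fin m × Fin n) 𝔽) :=
  Ideal.span {f | IsMinor 𝔽 m n s f}



/-! ### Ideals of minors of an arbitrary matrix -/

section Minors

variable {R S ι κ : Type*} [CommRing R] [CommRing S]

/-- The ideal generated by the determinants of all `j × j` matrices obtained from `M` by
selecting rows and columns, repetitions allowed. -/
def minorsOf (M : Matrix ι κ R) (j : ℕ) : Ideal R :=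
  Ideal.span {x | ∃ (f : Fin j → ι) (g : Fin j → κ), x = (M.submatrix f g).det}

lemma det_submatrix_mem_minorsOf (M : Matrix ι κ R) {α : Type*} [Fintype α] [DecidableEq α]
    {j : ℕ} (hα : Fintype.card α = j) (f : α → ι) (g : α → κ) :
    (M.submatrix f g).det ∈ minorsOf M j := by
  let e := Fintype.equivFinOfCardEq hα
  refine Ideal.subset_span ⟨f ∘ e.symm, g ∘ e.symm, ?_⟩
  rw [← Matrix.det_submatrix_equiv_self e.symm, Matrix.submatrix_submatrix]

lemma minorsOf_le {M : Matrix ι κ R} {j : ℕ} {I : Ideal R}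
    (h : ∀ (f : Fin j → ι) (g : Fin j → κ), (M.submatrix f g).det ∈ I) : minorsOf M j ≤ I := by
  rw [minorsOf, Ideal.span_le]
  rintro _ ⟨f, g, rfl⟩
  exact h f g

lemma map_minorsOf (φ : R →+* S) (M : Matrix ι κ R) (j : ℕ) :
    (minorsOf M j).map φ = minorsOf (M.map φ) j := by
  rw [minorsOf, Ideal.map_span, minorsOf]
  congr 1
  ext x
  constructor
  · rintro ⟨_, ⟨f, g, rfl⟩, rfl⟩
    exact ⟨f, g, by rw [RingHom.map_det]; rfl⟩
  · rintro ⟨f, g, rfl⟩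
    exact ⟨_, ⟨f, g, rfl⟩, by rw [RingHom.map_det]; rfl⟩

lemma minorsOf_zero (M : Matrix ι κ R) : minorsOf M 0 = ⊤ := by
  rw [Ideal.eq_top_iff_one]
  exact Ideal.subset_span ⟨Fin.elim0, Fin.elim0, by simp⟩

lemma minorsOf_smul (d : R) (M : Matrix ι κ R) (j : ℕ) :
    minorsOf (d • M) j = Ideal.span {d ^ j} * minorsOf M j := by
  rw [minorsOf, minorsOf, Ideal.span_mul_span']
  congr 1
  ext x
  simp only [Set.mem_mul, Set.mem_singleton_iff, Set.mem_ofPred_eq]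
  constructor
  · rintro ⟨f, g, rfl⟩
    exact ⟨_, rfl, _, ⟨f, g, rfl⟩, by
      rw [Matrix.submatrix_smul, Pi.smul_apply, Pi.smul_apply, Matrix.det_smul, Fintype.card_fin]⟩
  · rintro ⟨_, rfl, _, ⟨f, g, rfl⟩, rfl⟩
    exact ⟨f, g, by
      rw [Matrix.submatrix_smul, Pi.smul_apply, Pi.smul_apply, Matrix.det_smul, Fintype.card_fin]⟩

lemma minorsOf_reindex {ι' κ' : Type*} (e : ι' ≃ ι) (e' : κ' ≃ κ) (M : Matrix ι κ R) (j : ℕ) :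
    minorsOf (M.submatrix e e') j = minorsOf M j := by
  apply le_antisymm <;> refine minorsOf_le fun f g => ?_
  · rw [Matrix.submatrix_submatrix]
    exact Ideal.subset_span ⟨_, _, rfl⟩
  · refine Ideal.subset_span ⟨e.symm ∘ f, e'.symm ∘ g, ?_⟩
    rw [Matrix.submatrix_submatrix]
    congr 2 <;> ext <;> simp

/-- Expansion along the first column. -/
lemma det_mem_of_forall_succAbove {n : ℕ} (W : Matrix (Fin (n + 1)) (Fin (n + 1)) R) (I : Ideal R)
    (h : ∀ i : Fin (n + 1), (W.submatrix i.succAbove Fin.succ).det ∈ I) : W.det ∈ I := by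
  rw [Matrix.det_succ_column_zero]
  exact Ideal.sum_mem _ fun i _ => Ideal.mul_mem_left _ _ (h i)

/-- Adding a rank one matrix to `Z` moves the minors of size `j + 1` into the ideal of minors of
`Z` of size `j`. -/
lemma det_add_vecMulVec_mem (Z : Matrix ι κ R) (u : ι → R) (v : κ → R) {j : ℕ}
    (f : Fin (j + 1) → ι) (g : Fin (j + 1) → κ) :
    ((Z + Matrix.vecMulVec u v).submatrix f g).det ∈ minorsOf Z j := by
  let N : Matrix (Fin (j + 2)) (Fin (j + 2)) R := Matrix.of (Fin.cons
    (Fin.cons 1 fun c => - v (g c)) fun i => Fin.cons (u (f i)) fun c => Z (f i) (g c))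
  let N' : Matrix (Fin (j + 2)) (Fin (j + 2)) R := Matrix.of (Fin.cons
    (Fin.cons 1 fun c => - v (g c)) fun i => Fin.cons 0 fun c =>
      Z (f i) (g c) + u (f i) * v (g c))
  have hN' : N'.det = ((Z + Matrix.vecMulVec u v).submatrix f g).det := by
    rw [Matrix.det_succ_column_zero, Fin.sum_univ_succ]
    simp only [N', Matrix.of_apply, Fin.cons_zero, Fin.cons_succ]
    simp
    rfl
  have hNN' : N'.det = N.det := by
    refine Matrix.det_eq_of_forall_row_eq_smul_add_const
      (Fin.cons 0 fun i => - u (f i)) 0 rfl ?_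
    intro i c
    refine Fin.cases ?_ (fun i => ?_) i <;> refine Fin.cases ?_ (fun c => ?_) c <;>
      simp [N, N']
  rw [← hN', hNN', ← Matrix.det_transpose]
  refine det_mem_of_forall_succAbove _ _ fun i => ?_
  rw [← Matrix.det_transpose, Matrix.transpose_submatrix, Matrix.transpose_transpose]
  refine det_mem_of_forall_succAbove _ _ fun i' => ?_
  have hc : ∀ c : Fin j, i.succAbove c.succ ≠ 0 := fun c hc => by
    rcases eq_or_ne i 0 with rfl | hi
    · simp at hc
    · exact Fin.succ_ne_zero c (Fin.succAbove_right_injective (hc.trans (by simp [hi])))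
  refine Ideal.subset_span ⟨f ∘ i'.succAbove, fun c => g ((i.succAbove c.succ).pred (hc c)), ?_⟩
  congr 1
  ext a c
  obtain ⟨b, hb⟩ := Fin.exists_succ_eq_of_ne_zero (hc c)
  simp [N, ← hb]

end Minors

/-! ### Elementary divisors over a valuation ring -/

section ValuationRing

/-- Splitting off a pivot equal to `1`. -/
lemma exists_minorsOf_succ_eq {R ι κ : Type*} [CommRing R] (M : Matrix ι κ R) {a : ι} {b : κ}
    (hab : M a b = 1) : ∃ M' : Matrix ι κ R, ∀ j, minorsOf M (j + 1) = minorsOf M' j := by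
  set Z : Matrix ι κ R := M - Matrix.vecMulVec (fun i => M i b) (M a) with hZ
  have hMZ : M = Z + Matrix.vecMulVec (fun i => M i b) (M a) := by simp [hZ]
  refine ⟨Z, fun j => le_antisymm (minorsOf_le fun f g => ?_) (minorsOf_le fun f g => ?_)⟩
  · rw [hMZ]
    exact det_add_vecMulVec_mem _ _ _ f g
  · have h := det_submatrix_mem_minorsOf M (α := Unit ⊕ Fin j) (j := j + 1)
      (by simp [add_comm]) (Sum.elim (fun _ => a) f) (Sum.elim (fun _ => b) g)
    have h' : M.submatrix (Sum.elim (fun _ : Unit => a) f) (Sum.elim (fun _ : Unit => b) g) =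
        Matrix.fromBlocks 1 (Matrix.of fun _ c => M a (g c)) (Matrix.of fun r _ => M (f r) b)
          (M.submatrix f g) := by
      ext (i | i) (c | c) <;> simp [hab]
    rw [h', Matrix.det_fromBlocks_one₁₁] at h
    convert h using 2
    ext i c
    simp [hZ, Matrix.mul_apply, Matrix.vecMulVec_apply]

variable {V : Type*} [CommRing V] [IsDomain V] [ValuationRing V]

lemma exists_dvd_of_finite {α : Type*} [Finite α] [Nonempty α] (f : α → V) :
    ∃ a, ∀ b, f a ∣ f b := by
  have := Fintype.ofFinite α
  suffices h : ∀ s : Finset α, s.Nonempty → ∃ a, ∀ b ∈ s, f a ∣ f b by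
    obtain ⟨a, ha⟩ := h Finset.univ Finset.univ_nonempty
    exact ⟨a, fun b => ha b (Finset.mem_univ b)⟩
  intro s hs
  induction hs using Finset.Nonempty.cons_induction with
  | singleton a => exact ⟨a, by simp⟩
  | cons a s _ _ ih =>
    obtain ⟨c, hc⟩ := ih
    rcases ValuationRing.dvd_total (f a) (f c) with h | h
    · exact ⟨a, by simpa using fun b hb => h.trans (hc b hb)⟩
    · exact ⟨c, by simpa using ⟨h, hc⟩⟩

lemma exists_minorsOf_succ_eq_span_mul {ι κ : Type*} [Finite ι] [Finite κ] (M : Matrix ι κ V) :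
    ∃ (d : V) (M' : Matrix ι κ V),
      ∀ j, minorsOf M (j + 1) = Ideal.span {d ^ (j + 1)} * minorsOf M' j := by
  rcases eq_or_ne M 0 with rfl | hM
  · refine ⟨0, 0, fun j => ?_⟩
    have := minorsOf_smul (0 : V) (0 : Matrix ι κ V) (j + 1)
    rw [zero_smul] at this
    rw [this]
    simp
  obtain ⟨a₀, b₀, h₀⟩ : ∃ a b, M a b ≠ 0 := by
    by_contra! h
    exact hM (Matrix.ext h)
  have : Nonempty (ι × κ) := ⟨(a₀, b₀)⟩
  obtain ⟨⟨a, b⟩, h⟩ := exists_dvd_of_finite fun x : ι × κ => M x.1 x.2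
  choose N hN using fun i c => h (i, c)
  have hMN : M = M a b • Matrix.of N := by
    ext i c
    simpa using hN i c
  have hd : M a b ≠ 0 := fun h0 => h₀ (by simpa [h0] using h (a₀, b₀))
  obtain ⟨M', hM'⟩ := exists_minorsOf_succ_eq (Matrix.of N) (a := a) (b := b)
    (mul_left_cancel₀ hd (by simpa using (hN a b).symm))
  exact ⟨M a b, M', fun j => by rw [← hM', ← minorsOf_smul, ← hMN]⟩

/-- The ideals of minors of a matrix over a valuation ring are generated by products of
elementary divisors; `w i` is the quotient of two consecutive elementary divisors. -/
lemma exists_minorsOf_eq_span_prod {ι κ : Type*} [Finite ι] [Finite κ] (M : Matrix ι κ V) :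
    ∃ w : ℕ → V, ∀ j, minorsOf M j = Ideal.span {∏ k ∈ Finset.range j, w k ^ (j - k)} := by
  choose d N hN using fun M : Matrix ι κ V => exists_minorsOf_succ_eq_span_mul M
  refine ⟨fun k => d (N^[k] M), fun j => ?_⟩
  induction j generalizing M with
  | zero => simp [minorsOf_zero]
  | succ j ih =>
    rw [hN, ih (N M), Ideal.span_singleton_mul_span_singleton, Finset.prod_range_succ', mul_comm]
    simp

end ValuationRing

/-! ### A valuative criterion for integral dependence on an ideal -/

section Integral

variable {R : Type*} [CommRing R]

/-- For an ideal `J` containing `z`, the ring of fractions `y / z ^ l` with `y ∈ J ^ l`. -/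
def fractionSubring (K : Type*) [Field K] [Algebra R K] (J : Ideal R) {z : R} (hz : z ∈ J) :
    Subring K where
  carrier := {x | ∃ l, ∃ y ∈ J ^ l, x * algebraMap R K z ^ l = algebraMap R K y}
  mul_mem' := by
    rintro x x' ⟨l, y, hy, h⟩ ⟨l', y', hy', h'⟩
    refine ⟨l + l', y * y', by rw [pow_add]; exact Ideal.mul_mem_mul hy hy', ?_⟩
    rw [map_mul, ← h, ← h']
    ring
  one_mem' := ⟨0, 1, by simp, by simp⟩
  add_mem' := by
    rintro x x' ⟨l, y, hy, h⟩ ⟨l', y', hy', h'⟩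
    refine ⟨l + l', y * z ^ l' + z ^ l * y', ?_, ?_⟩
    · rw [pow_add]
      exact add_mem (Ideal.mul_mem_mul hy (Ideal.pow_mem_pow hz _))
        (Ideal.mul_mem_mul (Ideal.pow_mem_pow hz _) hy')
    · rw [map_add, map_mul, map_mul, ← h, ← h', map_pow, map_pow]
      ring
  zero_mem' := ⟨0, 0, by simp, by simp⟩
  neg_mem' := by
    rintro x ⟨l, y, hy, h⟩
    exact ⟨l, -y, neg_mem hy, by rw [neg_mul, h, map_neg]⟩

/-- The ideal of `fractionSubring K J hz` generated by the fractions `h / z` with `h ∈ I`. -/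
def fractionIdeal (K : Type*) [Field K] [Algebra R K] (I J : Ideal R) {z : R} (hz : z ∈ J) :
    Ideal (fractionSubring K J hz) where
  carrier := {x | ∃ l, ∃ y ∈ I * J ^ l, (x : K) * algebraMap R K z ^ (l + 1) = algebraMap R K y}
  add_mem' := by
    rintro x x' ⟨l, y, hy, h⟩ ⟨l', y', hy', h'⟩
    refine ⟨l + l' + 1, y * z ^ (l' + 1) + y' * z ^ (l + 1), ?_, ?_⟩
    · rw [add_assoc, pow_add, ← mul_assoc]
      refine add_mem (Ideal.mul_mem_mul hy (Ideal.pow_mem_pow hz _)) ?_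
      rw [mul_assoc, ← pow_add, show l + (l' + 1) = l' + (l + 1) by ring, pow_add, ← mul_assoc]
      exact Ideal.mul_mem_mul hy' (Ideal.pow_mem_pow hz _)
    · rw [map_add, map_mul, map_mul, ← h, ← h', map_pow, map_pow, Subring.coe_add]
      ring
  zero_mem' := ⟨0, 0, by simp, by simp⟩
  smul_mem' := by
    rintro c x ⟨l', y', hy', h'⟩
    obtain ⟨l, y, hy, h⟩ := c.2
    refine ⟨l + l', y * y', ?_, ?_⟩
    · rw [pow_add, ← mul_assoc, mul_comm I, mul_assoc]
      exact Ideal.mul_mem_mul hy hy'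
    · rw [map_mul, ← h, ← h', smul_eq_mul, Subring.coe_mul]
      ring

/-- If `z` lies in the extension of `I` to every valuation ring of the fraction field, then the
fractions `h / z` with `h ∈ I` generate the unit ideal. -/
lemma fractionIdeal_eq_top (K : Type*) [Field K] [Algebra R K] [IsFractionRing R K]
    (I J : Ideal R) (hIJ : I ≤ J) {z : R} (hzJ : z ∈ J) (hz : z ≠ 0)
    (h : ∀ (V : ValuationSubring K) (φ : R →+* V),
      (∀ r, (φ r : K) = algebraMap R K r) → φ z ∈ I.map φ) :
    fractionIdeal K I J hzJ = ⊤ := by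
  have hzK : algebraMap R K z ≠ 0 := by
    simpa using hz
  by_contra htop
  obtain ⟨V, hBV, hV⟩ := Ideal.image_subset_nonunits_valuationSubring _ htop
  have hRV : ∀ r, algebraMap R K r ∈ V := fun r => hBV ⟨0, r, by simp, by simp⟩
  let φ : R →+* V := (algebraMap R K).codRestrict V.toSubring hRV
  have hφ : I.map φ ≤ Ideal.span {φ z} * IsLocalRing.maximalIdeal V := by
    rw [Ideal.map_le_iff_le_comap]
    intro x hx
    have hxz : algebraMap R K x / algebraMap R K z ∈ fractionSubring K J hzJ :=
      ⟨1, x, by simpa using hIJ hx, by simp [hzK]⟩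
    have hmem : algebraMap R K x / algebraMap R K z ∈ V.nonunits :=
      hV ⟨⟨_, hxz⟩, ⟨0, x, by simpa using hx, by simp [hzK]⟩, rfl⟩
    rw [← SetLike.mem_coe, ← V.image_maximalIdeal] at hmem
    obtain ⟨y, hy, hyx⟩ := hmem
    have : φ x = φ z * y := by
      apply Subtype.ext
      change algebraMap R K x = algebraMap R K z * y
      rw [hyx]
      field_simp
    rw [Ideal.mem_comap, this]
    exact Ideal.mul_mem_mul (Ideal.mem_span_singleton_self _) hy
  have h1 := hφ (h V φ fun r => rfl)
  rw [Ideal.mem_span_singleton_mul] at h1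
  obtain ⟨y, hy, hyz⟩ := h1
  have hφz : φ z ≠ 0 := fun h0 => hzK (congrArg Subtype.val h0)
  have : y = 1 := mul_left_cancel₀ hφz (by rw [hyz, mul_one])
  exact (Ideal.ne_top_iff_one _).1 (IsLocalRing.maximalIdeal.isMaximal V).ne_top (this ▸ hy)

lemma pow_add_le_of_pow_succ_mem {I J : Ideal R} {z : R} (hJ : J = I ⊔ Ideal.span {z}) {l : ℕ}
    (hzl : z ^ (l + 1) ∈ I * J ^ l) (a : ℕ) : J ^ (l + a) ≤ I ^ a * J ^ l := by
  have hzJ : z ∈ J := hJ ▸ le_sup_right (a := I) (Ideal.mem_span_singleton_self z)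
  have hJl : J ^ (l + 1) ≤ I * J ^ l := by
    have hle : ∀ i, J ^ (i + 1) ≤ I * J ^ i ⊔ Ideal.span {z ^ (i + 1)} := by
      intro i
      induction i with
      | zero => simp [hJ]
      | succ i ih =>
        calc J ^ (i + 1 + 1) = J ^ (i + 1) * I ⊔ J ^ (i + 1) * Ideal.span {z} := by
              rw [pow_succ, ← Ideal.mul_sup, ← hJ]
          _ ≤ I * J ^ (i + 1) ⊔ Ideal.span {z ^ (i + 1 + 1)} := by
              refine sup_le (by rw [mul_comm]; exact le_sup_left) ?_
              refine (Ideal.mul_mono_left ih).trans ?_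
              rw [Ideal.sup_mul]
              refine sup_le_sup ?_ ?_
              · rw [mul_assoc]
                refine Ideal.mul_mono_right ?_
                rw [pow_succ]
                exact Ideal.mul_mono_right ((Ideal.span_singleton_le_iff_mem _).2 hzJ)
              · rw [Ideal.span_singleton_mul_span_singleton, ← pow_succ]
    exact (hle l).trans (sup_le le_rfl ((Ideal.span_singleton_le_iff_mem _).2 hzl))
  induction a with
  | zero => simp
  | succ a ih =>
    calc J ^ (l + (a + 1)) = J ^ (l + a) * J := by rw [← add_assoc, pow_succ]
      _ ≤ I ^ a * J ^ l * J := Ideal.mul_mono_left ih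
      _ = I ^ a * J ^ (l + 1) := by rw [mul_assoc, ← pow_succ]
      _ ≤ I ^ a * (I * J ^ l) := Ideal.mul_mono_right hJl
      _ = I ^ (a + 1) * J ^ l := by rw [← mul_assoc, ← pow_succ]

/-- If `z` lies in the extension of `I` to every valuation ring of the fraction field, then the
powers of `z` lie in the powers of `I` up to a bounded shift. -/
theorem exists_pow_add_mem_pow (K : Type*) [Field K] [Algebra R K] [IsFractionRing R K]
    (I : Ideal R) {z : R} (hz : z ≠ 0)
    (h : ∀ (V : ValuationSubring K) (φ : R →+* V),
      (∀ r, (φ r : K) = algebraMap R K r) → φ z ∈ I.map φ) :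
    ∃ l, ∀ a, z ^ (l + a) ∈ I ^ a := by
  have hzJ : z ∈ I ⊔ Ideal.span {z} :=
    le_sup_right (a := I) (Ideal.mem_span_singleton_self z)
  have h1 : (1 : fractionSubring K _ hzJ) ∈ fractionIdeal K I _ hzJ := by
    rw [fractionIdeal_eq_top K I _ le_sup_left hzJ hz h]
    exact Submodule.mem_top
  obtain ⟨l, y, hy, hyz⟩ := h1
  have hzl : z ^ (l + 1) ∈ I * (I ⊔ Ideal.span {z}) ^ l := by
    have hzy : algebraMap R K (z ^ (l + 1)) = algebraMap R K y := by
      rw [← hyz, map_pow, OneMemClass.coe_one, one_mul]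
    rwa [IsFractionRing.injective R K hzy]
  refine ⟨l, fun a => ?_⟩
  have hle : (I ⊔ Ideal.span {z}) ^ (l + a) ≤ I ^ a :=
    (pow_add_le_of_pow_succ_mem rfl hzl a).trans Ideal.mul_le_left
  exact hle (Ideal.pow_mem_pow hzJ _)

end Integral

/-! ### Minors of a matrix with an invertible block -/

section Schur

variable {Q : Type*} [CommRing Q]

lemma span_image_pow_eq_bot {ι : Type*} (y : ι → Q) {q : ℕ} (hy : ∀ i, y i ^ q = 0)
    (s : Finset ι) : Ideal.span (y '' s) ^ (s.card * q + 1) = ⊥ := by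
  classical
  induction s using Finset.induction_on with
  | empty => simp
  | insert a s has ih =>
    rw [Finset.coe_insert, Set.image_insert_eq, Ideal.span_insert, Finset.card_insert_of_notMem has,
      show (s.card + 1) * q + 1 = q + (s.card * q + 1) by ring, eq_bot_iff]
    refine Ideal.sup_pow_add_le_pow_sup_pow.trans ?_
    rw [ih, Ideal.span_singleton_pow, hy]
    simp

lemma span_range_pow_eq_bot {ι : Type*} [Fintype ι] (y : ι → Q) {q : ℕ} (hy : ∀ i, y i ^ q = 0) :
    Ideal.span (Set.range y) ^ (Fintype.card ι * q + 1) = ⊥ := by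
  simpa using span_image_pow_eq_bot y hy Finset.univ

/-- A matrix which modulo `J` factors through rank `|κ|` has determinant in a power of `J`. -/
lemma det_add_mul_mem_pow {τ κ : Type*} [Fintype τ] [DecidableEq τ] [Fintype κ] [DecidableEq κ]
    {J : Ideal Q} {Z : Matrix τ τ Q} (hZ : ∀ i j, Z i j ∈ J) (P : Matrix τ κ Q)
    (N : Matrix κ τ Q) : (Z + P * N).det ∈ J ^ (Fintype.card τ - Fintype.card κ) := by
  have h : (Z + P * N).det = (Matrix.fromBlocks 1 (-N) P Z).det := by
    rw [Matrix.det_fromBlocks_one₁₁]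
    simp
  rw [h, Matrix.det_apply]
  refine Ideal.sum_mem _ fun σ _ => ?_
  rw [Units.smul_def]
  refine zsmul_mem ?_ _
  rw [Fintype.prod_sum_type]
  refine Ideal.mul_mem_left _ _ ?_
  let s : Finset τ := {i | (σ (Sum.inr i)).isRight}
  have hs : Fintype.card τ - Fintype.card κ ≤ s.card := by
    have h1 : (Finset.univ \ s).card ≤ Fintype.card κ := by
      let e : τ → Option κ := fun i => (σ (Sum.inr i)).getLeft?
      rw [← Finset.card_univ (α := κ),
        ← Finset.card_map (s := Finset.univ (α := κ)) Function.Embedding.some]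
      refine Finset.card_le_card_of_injOn e ?_ ?_
      · intro i hi
        rcases hσ : σ (Sum.inr i) with c | c <;> simp [s, hσ] at hi
        simp [e, hσ]
      · intro i hi i' hi' h
        rcases hσ : σ (Sum.inr i) with c | c <;> simp [s, hσ] at hi
        rcases hσ' : σ (Sum.inr i') with c' | c' <;> simp [s, hσ'] at hi'
        simp only [e, hσ, hσ', Sum.getLeft?_inl, Option.some.injEq] at h
        subst h
        simpa using σ.injective (hσ.trans hσ'.symm)
    have h2 := Finset.card_sdiff_add_card_eq_card (Finset.subset_univ s)
    rw [Finset.card_univ] at h2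
    omega
  refine Ideal.pow_le_pow_right hs ?_
  rw [← Finset.prod_sdiff (Finset.subset_univ s), ← Finset.prod_const]
  refine Ideal.mul_mem_left _ _ (Ideal.prod_mem_prod fun i hi => ?_)
  rcases hσ : σ (Sum.inr i) with c | c <;> simp [s, hσ] at hi
  simpa using hZ c i

/-- If the upper left block of size `κ` is invertible, the minors of size `t` lie in the
`(t - |κ|)`-th power of the ideal generated by the entries of the Schur complement. -/
lemma minorsOf_fromBlocks_le {κ ι ι' : Type*} [Fintype κ] [DecidableEq κ]
    {A : Matrix κ κ Q} (hA : IsUnit A.det) (B : Matrix κ ι' Q) (C : Matrix ι κ Q)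
    (D : Matrix ι ι' Q) (t : ℕ) :
    minorsOf (Matrix.fromBlocks A B C D) t ≤
      Ideal.span (Set.range fun x : ι × ι' => (D - C * A⁻¹ * B) x.1 x.2) ^
        (t - Fintype.card κ) := by
  set J := Ideal.span (Set.range fun x : ι × ι' => (D - C * A⁻¹ * B) x.1 x.2) with hJ
  refine minorsOf_le fun f g => ?_
  have hM : Matrix.fromBlocks A B C D =
      Matrix.fromBlocks 0 0 0 (D - C * A⁻¹ * B) +
        Matrix.fromRows A C * Matrix.fromCols 1 (A⁻¹ * B) := by
    rw [Matrix.fromRows_mul_fromCols, Matrix.fromBlocks_add, ← Matrix.mul_assoc,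
      Matrix.mul_nonsing_inv _ hA, ← Matrix.mul_assoc]
    simp
  have hsub : (Matrix.fromBlocks A B C D).submatrix f g =
      (Matrix.fromBlocks 0 0 0 (D - C * A⁻¹ * B)).submatrix f g +
        (Matrix.fromRows A C).submatrix f id * (Matrix.fromCols 1 (A⁻¹ * B)).submatrix id g := by
    rw [hM, Matrix.submatrix_add, Pi.add_apply, Pi.add_apply,
      Matrix.submatrix_mul _ _ f id g Function.bijective_id]
  rw [hsub]
  have := det_add_mul_mem_pow (J := J)
    (Z := (Matrix.fromBlocks (0 : Matrix κ κ Q) 0 0 (D - C * A⁻¹ * B)).submatrix f g)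
    (fun i j => ?_) ((Matrix.fromRows A C).submatrix f id)
    ((Matrix.fromCols 1 (A⁻¹ * B)).submatrix id g)
  · simpa using this
  · rw [Matrix.submatrix_apply]
    rcases f i with a | a <;> rcases g j with b | b <;> simp only [Matrix.fromBlocks_apply₁₁,
      Matrix.fromBlocks_apply₁₂, Matrix.fromBlocks_apply₂₁, Matrix.fromBlocks_apply₂₂,
      Matrix.zero_apply, zero_mem]
    exact Ideal.subset_span ⟨(a, b), rfl⟩

/-- Powers of the ideal of minors vanish when the Schur complement has entries killed by `q`-th
powers. -/
lemma minorsOf_fromBlocks_pow_eq_bot {κ ι ι' : Type*} [Fintype κ] [DecidableEq κ] [Fintype ι]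
    [Fintype ι'] {A : Matrix κ κ Q} (hA : IsUnit A.det) (B : Matrix κ ι' Q) (C : Matrix ι κ Q)
    (D : Matrix ι ι' Q) {q : ℕ} {n : Ideal Q} (hn : ∀ y ∈ n, y ^ q = 0)
    (hC : ∀ i j, C i j ∈ n) (hD : ∀ i j, D i j ∈ n) {t r : ℕ}
    (hr : Fintype.card ι * Fintype.card ι' * q < r * (t - Fintype.card κ)) :
    minorsOf (Matrix.fromBlocks A B C D) t ^ r = ⊥ := by
  rw [eq_bot_iff]
  refine (Ideal.pow_right_mono (minorsOf_fromBlocks_le hA B C D t) r).trans ?_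
  rw [← pow_mul, mul_comm, ← span_range_pow_eq_bot
    (fun x : ι × ι' => (D - C * A⁻¹ * B) x.1 x.2) (q := q)]
  · exact Ideal.pow_le_pow_right (by rwa [Fintype.card_prod, Nat.succ_le_iff])
  · rintro ⟨i, j⟩
    refine hn _ (sub_mem (hD i j) ?_)
    rw [Matrix.mul_assoc, Matrix.mul_apply]
    exact sum_mem fun l _ => Ideal.mul_mem_right _ _ (hC i l)

end Schur

/-! ### The bracket powers of the homogeneous maximal ideal -/

section Bracket

variable {p : ℕ} {𝔽 σ : Type*} [Field 𝔽]

lemma mem_bracketPow_of_forall_support {q : ℕ} {f : MvPolynomial σ 𝔽}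
    (h : ∀ μ ∈ f.support, ∃ i, q ≤ μ i) : f ∈ bracketPow (maxIdl 𝔽 σ) q := by
  rw [f.as_sum]
  refine sum_mem fun μ hμ => ?_
  obtain ⟨i, hi⟩ := h μ hμ
  have hle : Finsupp.single i q ≤ μ := by simpa using hi
  rw [← tsub_add_cancel_of_le hle, ← mul_one (coeff _ f), ← monomial_mul]
  refine Ideal.mul_mem_left _ _ (Ideal.subset_span ⟨X i, Ideal.subset_span ⟨i, rfl⟩, 
    X_pow_eq_monomial⟩)

lemma mem_bracketPow_iff (hp : p.Prime) [CharP 𝔽 p] {e : ℕ} {f : MvPolynomial σ 𝔽} :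
    f ∈ bracketPow (maxIdl 𝔽 σ) (p ^ e) ↔ ∀ μ ∈ f.support, ∃ i, p ^ e ≤ μ i := by
  refine ⟨fun hf => ?_, mem_bracketPow_of_forall_support⟩
  have := Fact.mk hp
  have hle : bracketPow (maxIdl 𝔽 σ) (p ^ e) ≤
      Ideal.span ((fun μ => monomial μ (1 : 𝔽)) '' Set.range fun i => Finsupp.single i (p ^ e)) := by
    rw [bracketPow, Ideal.span_le]
    rintro _ ⟨a, ha, rfl⟩
    simp only [SetLike.mem_coe, maxIdl] at ha ⊢
    induction ha using Submodule.span_induction with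
    | mem x hx =>
      obtain ⟨i, rfl⟩ := hx
      exact Ideal.subset_span ⟨_, ⟨i, rfl⟩, by rw [X_pow_eq_monomial]⟩
    | zero => simp [hp.ne_zero]
    | add x y _ _ hx hy =>
      rw [add_pow_char_pow]
      exact add_mem hx hy
    | smul c x _ hx =>
      rw [smul_eq_mul, mul_pow]
      exact Ideal.mul_mem_left _ _ hx
  intro μ hμ
  obtain ⟨_, ⟨i, rfl⟩, hi⟩ := mem_ideal_span_monomial_image.1 (hle hf) μ hμ
  exact ⟨i, by simpa using hi⟩

/-- Translating the variables by multiples of a new parameter `s` preserves not being in a bracket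
power of the homogeneous maximal ideal. -/
lemma translate_notMem_bracketPow (hp : p.Prime) [CharP 𝔽 p] {e : ℕ} {f : MvPolynomial σ 𝔽}
    (hf : f ∉ bracketPow (maxIdl 𝔽 σ) (p ^ e)) (a : σ → 𝔽) {K : Type*} [Field K] [CharP K p]
    (ψ : Polynomial 𝔽 →+* K) (hψ : Function.Injective ψ) :
    eval₂Hom (C.comp (ψ.comp Polynomial.C))
      (fun i => X i + C (ψ (Polynomial.C (a i) * Polynomial.X))) f ∉
        bracketPow (maxIdl K σ) (p ^ e) := by
  rw [mem_bracketPow_iff hp] at hf ⊢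
  push Not at hf ⊢
  obtain ⟨μ, hμ, hμe⟩ := hf
  refine ⟨μ, ?_, hμe⟩
  let Φ : MvPolynomial σ 𝔽 →+* MvPolynomial σ (Polynomial 𝔽) :=
    eval₂Hom (C.comp Polynomial.C) (fun i => X i + C (Polynomial.C (a i) * Polynomial.X))
  have h0 : ((map (Polynomial.evalRingHom 0)).comp Φ : MvPolynomial σ 𝔽 →+* _) =
      RingHom.id _ := by
    ext i <;> simp [Φ]
  have h1 : ((map ψ).comp Φ : MvPolynomial σ 𝔽 →+* _) = eval₂Hom (C.comp (ψ.comp Polynomial.C))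
      (fun i => X i + C (ψ (Polynomial.C (a i) * Polynomial.X))) := by
    ext i <;> simp [Φ]
  rw [← h1, mem_support_iff, RingHom.comp_apply, coeff_map, map_ne_zero_iff _ hψ]
  intro h
  have h2 := congrArg (coeff μ) (RingHom.congr_fun h0 f)
  rw [RingHom.comp_apply, coeff_map, h, map_zero] at h2
  exact mem_support_iff.1 hμ h2.symm

end Bracket

/-! ### The upper bound -/

section Upper

variable {p : ℕ} {𝔽 : Type*} [Field 𝔽] {m n t : ℕ}

lemma minorsIdeal_eq_minorsOf : minorsIdeal 𝔽 m n t = minorsOf (genMat 𝔽 m n) t := by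
  refine le_antisymm (Ideal.span_mono ?_) (minorsOf_le fun f g => ?_)
  · rintro _ ⟨f, g, -, -, rfl⟩
    exact ⟨f, g, rfl⟩
  · by_cases hf : Function.Injective f
    · by_cases hg : Function.Injective g
      · have hfm := (Tuple.monotone_sort f).strictMono_of_injective (hf.comp (Tuple.sort f).injective)
        have hgm := (Tuple.monotone_sort g).strictMono_of_injective (hg.comp (Tuple.sort g).injective)
        have hmem : ((genMat 𝔽 m n).submatrix (f ∘ Tuple.sort f) (g ∘ Tuple.sort g)).det ∈
            minorsIdeal 𝔽 m n t := Ideal.subset_span ⟨_, _, hfm, hgm, rfl⟩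
        have h1 : (genMat 𝔽 m n).submatrix (f ∘ Tuple.sort f) (g ∘ Tuple.sort g) =
            (((genMat 𝔽 m n).submatrix f g).submatrix (Tuple.sort f) id).submatrix id
              (Tuple.sort g) := rfl
        rw [h1, Matrix.det_permute', Matrix.det_permute, ← mul_assoc, ← Int.cast_mul,
          ← Units.val_mul] at hmem
        refine (Ideal.unit_mul_mem_iff_mem _ ?_).1 hmem
        exact (Units.isUnit _).map (Int.castRingHom _)
      · obtain ⟨i, j, hij, hne⟩ := Function.not_injective_iff.1 hg
        rw [Matrix.det_zero_of_column_eq hne (by simp [hij])]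
        exact zero_mem _
    · obtain ⟨i, j, hij, hne⟩ := Function.not_injective_iff.1 hf
      rw [Matrix.det_zero_of_row_eq hne (by ext; simp [hij])]
      exact zero_mem _

lemma minorsIdeal_pow_le_bracketPow (hp : p.Prime) [CharP 𝔽 p] {k : ℕ} (hkm : k ≤ m) (hkn : k ≤ n)
    {e r : ℕ} (hr : (m - k) * (n - k) * p ^ e < r * (t - k)) :
    minorsIdeal 𝔽 m n t ^ r ≤ bracketPow (maxIdl 𝔽 (Fin m × Fin n)) (p ^ e) := by
  intro f hf
  by_contra hfq
  let K := FractionRing (Polynomial 𝔽)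
  let ψ : Polynomial 𝔽 →+* K := algebraMap _ _
  have hψ : Function.Injective ψ := IsFractionRing.injective _ _
  have : CharP K p := charP_of_injective_ringHom hψ p
  let a : Fin m × Fin n → 𝔽 := fun x => if (x.1 : ℕ) = x.2 ∧ (x.1 : ℕ) < k then 1 else 0
  have hΨ := translate_notMem_bracketPow hp hfq a ψ hψ
  set Ψ := eval₂Hom (C.comp (ψ.comp Polynomial.C))
      (fun i => X i + C (ψ (Polynomial.C (a i) * Polynomial.X))) with hΨdef
  let 𝔟 := bracketPow (maxIdl K (Fin m × Fin n)) (p ^ e)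
  let π := Ideal.Quotient.mk 𝔟
  let 𝔫 := (maxIdl K (Fin m × Fin n)).map π
  have hX : ∀ x, π (X x) ∈ 𝔫 := fun x => Ideal.mem_map_of_mem _ (Ideal.subset_span ⟨x, rfl⟩)
  have h𝔫 : ∀ y ∈ 𝔫, y ^ p ^ e = 0 := by
    intro y hy
    obtain ⟨y', hy', rfl⟩ := (Ideal.mem_map_iff_of_surjective π Ideal.Quotient.mk_surjective).1 hy
    rw [← map_pow]
    exact Ideal.Quotient.eq_zero_iff_mem.2 (Ideal.subset_span ⟨y', hy', rfl⟩)
  let s := π (C (ψ Polynomial.X))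
  have hs : IsUnit s := by
    refine ((IsUnit.mk0 _ ?_).map C).map π
    rw [map_ne_zero_iff _ hψ]
    exact Polynomial.X_ne_zero
  let em : Fin k ⊕ Fin (m - k) ≃ Fin m := finSumFinEquiv.trans (finCongr (by omega))
  let en : Fin k ⊕ Fin (n - k) ≃ Fin n := finSumFinEquiv.trans (finCongr (by omega))
  let M := ((genMat 𝔽 m n).map (π.comp Ψ)).submatrix em en
  have hM : ∀ i j, M i j = π (X (em i, en j)) +
      if (em i : ℕ) = en j ∧ (em i : ℕ) < k then s else 0 := by
    intro i j
    have : M i j = π (Ψ (X (em i, en j))) := rfl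
    rw [this, hΨdef]
    simp only [coe_eval₂Hom, eval₂_X, map_add, a, s]
    congr 1
    split_ifs <;> simp
  have hA : IsUnit M.toBlocks₁₁.det := by
    have h1 : M.toBlocks₁₁.det - s ^ k ∈ 𝔫 := by
      rw [← Ideal.Quotient.eq_zero_iff_mem, map_sub, RingHom.map_det, sub_eq_zero, map_pow]
      have : (Ideal.Quotient.mk 𝔫).mapMatrix M.toBlocks₁₁ =
          Matrix.diagonal fun _ => Ideal.Quotient.mk 𝔫 s := by
        ext i j
        rw [RingHom.mapMatrix_apply, Matrix.map_apply, Matrix.toBlocks₁₁, Matrix.of_apply, hM,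
          map_add, Ideal.Quotient.eq_zero_iff_mem.2 (hX _), zero_add, Matrix.diagonal_apply]
        simp only [em, en, Equiv.trans_apply, finSumFinEquiv_apply_left, finCongr_apply,
          Fin.val_cast, Fin.val_castAdd, Fin.is_lt, and_true, Fin.val_inj]
        split_ifs <;> simp
      rw [this, Matrix.det_diagonal]
      simp
    have h2 : IsNilpotent (M.toBlocks₁₁.det - s ^ k) := ⟨_, h𝔫 _ h1⟩
    simpa using h2.isUnit_add_left_of_commute (hs.pow k) (Commute.all _ _)
  have hC : ∀ i j, M.toBlocks₂₁ i j ∈ 𝔫 := by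
    intro i j
    rw [Matrix.toBlocks₂₁, Matrix.of_apply, hM, if_neg]
    · simpa using hX _
    · simp [em]
  have hD : ∀ i j, M.toBlocks₂₂ i j ∈ 𝔫 := by
    intro i j
    rw [Matrix.toBlocks₂₂, Matrix.of_apply, hM, if_neg]
    · simpa using hX _
    · simp [em]
  have hbot := minorsOf_fromBlocks_pow_eq_bot (t := t) (r := r) hA M.toBlocks₁₂ _ _ h𝔫 hC hD
    (by simpa using hr)
  rw [Matrix.fromBlocks_toBlocks, minorsOf_reindex, ← map_minorsOf, ← minorsIdeal_eq_minorsOf,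
    ← Ideal.map_pow] at hbot
  have hmem := Ideal.mem_map_of_mem (π.comp Ψ) hf
  rw [hbot] at hmem
  exact hΨ (Ideal.Quotient.eq_zero_iff_mem.1 hmem)

end Upper

/-! ### A product of minors with squarefree initial monomial -/

section Initial

variable {𝔽 : Type*} [Field 𝔽] {m n : ℕ}

/-- The grading homomorphism giving the variable `x_{ij}` the weight `i * j`. -/
noncomputable def weightHom (𝔽 : Type*) [Field 𝔽] (m n : ℕ) :
    MvPolynomial (Fin m × Fin n) 𝔽 →+* Polynomial (MvPolynomial (Fin m × Fin n) 𝔽) :=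
  eval₂Hom (Polynomial.C.comp C) fun x => Polynomial.C (X x) * Polynomial.X ^ ((x.1 : ℕ) * x.2)

lemma weightHom_monomial (μ : Fin m × Fin n →₀ ℕ) (c : 𝔽) : ∃ d,
    weightHom 𝔽 m n (monomial μ c) = Polynomial.C (monomial μ c) * Polynomial.X ^ d := by
  refine ⟨μ.sum fun x a => (x.1 : ℕ) * x.2 * a, ?_⟩
  rw [weightHom, coe_eval₂Hom, eval₂_monomial, monomial_eq, Finsupp.prod, Finsupp.prod, Finsupp.sum]
  simp only [mul_pow, Finset.prod_mul_distrib, ← pow_mul, Finset.prod_pow_eq_pow_sum,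
    RingHom.comp_apply, map_mul, map_prod, map_pow]
  ring

lemma leadingCoeff_weightHom_mem {q : ℕ} {J : Ideal (MvPolynomial (Fin m × Fin n) 𝔽)}
    (hJ : ∀ f, f ∈ J ↔ ∀ μ ∈ f.support, ∃ i, q ≤ μ i) {f : MvPolynomial (Fin m × Fin n) 𝔽}
    (hf : f ∈ J) : (weightHom 𝔽 m n f).leadingCoeff ∈ J := by
  classical
  refine Ideal.mem_map_C_iff.1 ?_ _
  rw [f.as_sum, map_sum]
  refine sum_mem fun μ hμ => ?_
  obtain ⟨d, hd⟩ := weightHom_monomial μ (coeff μ f)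
  rw [hd]
  refine Ideal.mul_mem_right _ _ (Ideal.mem_map_of_mem _ ((hJ _).2 fun ν hν => ?_))
  rw [Finset.mem_singleton.1 (support_monomial_subset hν)]
  exact (hJ f).1 hf μ hμ

lemma sum_perm_mul_lt {l : ℕ} {f g : Fin l → ℕ} (hf : StrictMono f) (hg : StrictMono g)
    {σ : Equiv.Perm (Fin l)} (hσ : σ ≠ 1) : ∑ i, f (σ i) * g i < ∑ i, f i * g i := by
  have hfg : Monovary f g := fun i j h => hf.monotone (hg.lt_iff_lt.1 h).le
  rw [hfg.sum_comp_perm_mul_lt_sum_mul_iff]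
  intro h
  apply hσ
  have hmono : Monotone σ := by
    intro i j hij
    rcases hij.eq_or_lt with rfl | hij
    · exact le_rfl
    · exact hf.le_iff_le.1 (h (hg hij))
  have := Subsingleton.elim
    ((hmono.strictMono_of_injective σ.injective).orderIsoOfSurjective σ σ.surjective)
    (OrderIso.refl (Fin l))
  exact Equiv.ext fun i => DFunLike.congr_fun this i

lemma leadingCoeff_weightHom_det {l : ℕ} {f : Fin l → Fin m} {g : Fin l → Fin n}
    (hf : StrictMono f) (hg : StrictMono g) :
    (weightHom 𝔽 m n ((genMat 𝔽 m n).submatrix f g).det).leadingCoeff = ∏ i, X (f i, g i) := by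
  set D := ∑ i, (f i : ℕ) * g i with hD
  have hdet : weightHom 𝔽 m n ((genMat 𝔽 m n).submatrix f g).det =
      ∑ σ : Equiv.Perm (Fin l), (Equiv.Perm.sign σ : ℤ) •
        (Polynomial.C (∏ i, X (f (σ i), g i)) * Polynomial.X ^ ∑ i, (f (σ i) : ℕ) * g i) := by
    rw [RingHom.map_det, Matrix.det_apply]
    refine Finset.sum_congr rfl fun σ _ => ?_
    rw [Units.smul_def, map_prod, ← Finset.prod_pow_eq_pow_sum, ← Finset.prod_mul_distrib]
    congr 1
    refine Finset.prod_congr rfl fun i _ => ?_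
    simp [weightHom, genMat]
  have hlt : ∀ σ : Equiv.Perm (Fin l), σ ≠ 1 → ∑ i, (f (σ i) : ℕ) * g i < D := fun σ hσ =>
    sum_perm_mul_lt (f := fun i => (f i : ℕ)) (g := fun i => (g i : ℕ)) hf hg hσ
  have hcoeff : (weightHom 𝔽 m n ((genMat 𝔽 m n).submatrix f g).det).coeff D =
      ∏ i, X (f i, g i) := by
    rw [hdet, Polynomial.finsetSum_coeff, Finset.sum_eq_single 1]
    · rw [Equiv.Perm.sign_one, Units.val_one, one_smul, Polynomial.coeff_C_mul_X_pow]
      exact if_pos rfl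
    · intro σ _ hσ
      rw [Polynomial.coeff_smul, Polynomial.coeff_C_mul, Polynomial.coeff_X_pow,
        if_neg (hlt σ hσ).ne', mul_zero, smul_zero]
    · simp
  have hdeg : (weightHom 𝔽 m n ((genMat 𝔽 m n).submatrix f g).det).natDegree ≤ D := by
    rw [hdet]
    refine Polynomial.natDegree_sum_le_of_forall_le _ _ fun σ _ => ?_
    refine (Polynomial.natDegree_smul_le _ _).trans
      ((Polynomial.natDegree_C_mul_X_pow_le _ _).trans ?_)
    rcases eq_or_ne σ 1 with rfl | hσ
    · simp [hD]
    · exact (hlt σ hσ).le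
  have hne : (weightHom 𝔽 m n ((genMat 𝔽 m n).submatrix f g).det).coeff D ≠ 0 := by
    rw [hcoeff]
    exact Finset.prod_ne_zero_iff.2 fun i _ => X_ne_zero _
  rw [Polynomial.leadingCoeff, le_antisymm hdeg (Polynomial.le_natDegree_of_ne_zero hne), hcoeff]

/-- Powers of a product of minors with pairwise disjoint main diagonals. -/
lemma prod_minors_pow_notMem_bracketPow {p : ℕ} (hp : p.Prime) [CharP 𝔽 p] {α : Type*} [Fintype α]
    {len : α → ℕ} {f : ∀ x, Fin (len x) → Fin m} {g : ∀ x, Fin (len x) → Fin n}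
    (hf : ∀ x, StrictMono (f x)) (hg : ∀ x, StrictMono (g x))
    (hfg : Function.Injective fun y : Σ x, Fin (len x) => (f y.1 y.2, g y.1 y.2))
    {e N : ℕ} (hN : N < p ^ e) :
    (∏ x, ((genMat 𝔽 m n).submatrix (f x) (g x)).det) ^ N ∉
      bracketPow (maxIdl 𝔽 (Fin m × Fin n)) (p ^ e) := by
  classical
  intro hmem
  have h := leadingCoeff_weightHom_mem (fun _ => mem_bracketPow_iff hp) hmem
  rw [map_pow, Polynomial.leadingCoeff_pow, map_prod, Polynomial.leadingCoeff_prod,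
    Finset.prod_congr rfl fun x _ => leadingCoeff_weightHom_det (hf x) (hg x)] at h
  have hmon : (∏ x, ∏ i, X (f x i, g x i) : MvPolynomial (Fin m × Fin n) 𝔽) =
      monomial (∑ y : Σ x, Fin (len x), Finsupp.single (f y.1 y.2, g y.1 y.2) 1) 1 := by
    rw [monomial_sum_one, Fintype.prod_sigma]
    rfl
  rw [hmon, monomial_pow, one_pow, mem_bracketPow_iff hp] at h
  obtain ⟨z, hz⟩ := h _ (by rw [support_monomial, if_neg one_ne_zero]; exact Finset.mem_singleton_self _)
  have hle : (∑ y : Σ x, Fin (len x), Finsupp.single (f y.1 y.2, g y.1 y.2) 1) z ≤ 1 := by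
    simp only [Finsupp.coe_finsetSum, Finset.sum_apply, Finsupp.single_apply]
    rw [← Finset.card_filter]
    refine Finset.card_le_one.2 fun y hy y' hy' => hfg ?_
    exact (Finset.mem_filter.1 hy).2.trans (Finset.mem_filter.1 hy').2.symm
  rw [Finsupp.smul_apply, smul_eq_mul] at hz
  have := Nat.mul_le_mul_left N hle
  omega

end Initial

/-! ### The lower bound -/

section Lower

variable {𝔽 : Type*} [Field 𝔽] {m n t : ℕ}

/-- The lengths of the diagonals of an `m × n` matrix, indexed by their starting cells in the first
row and in the first column, for `m ≤ n`. -/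
def diagLen (m n : ℕ) : Fin n ⊕ Fin (m - 1) → ℕ :=
  Sum.elim (fun j => min m (n - j)) (fun a => m - 1 - a)

/-- The rows met by a diagonal. -/
def diagRow (m n : ℕ) : ∀ x, Fin (diagLen m n x) → Fin m
  | .inl _, i => ⟨i, by have := i.2; simp only [diagLen, Sum.elim_inl] at this; omega⟩
  | .inr a, i => ⟨a + 1 + i, by have := i.2; simp only [diagLen, Sum.elim_inr] at this; omega⟩

/-- The columns met by a diagonal. -/
def diagCol (hmn : m ≤ n) : ∀ x, Fin (diagLen m n x) → Fin n
  | .inl j, i => ⟨j + i, by have := i.2; simp only [diagLen, Sum.elim_inl] at this; omega⟩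
  | .inr a, i => ⟨i, by have := i.2; simp only [diagLen, Sum.elim_inr] at this; omega⟩

lemma strictMono_diagRow (x) : StrictMono (diagRow m n x) := by
  intro i j hij
  rcases x with x | x <;> simpa [diagRow] using hij

lemma strictMono_diagCol (hmn : m ≤ n) (x) : StrictMono (diagCol hmn x) := by
  intro i j hij
  rcases x with x | x <;> simpa [diagCol] using hij

lemma diagLen_le (x) : diagLen m n x ≤ m := by
  rcases x with x | x <;> simp only [diagLen, Sum.elim_inl, Sum.elim_inr] <;> omega

lemma injective_diag (hmn : m ≤ n) :
    Function.Injective fun y : Σ x, Fin (diagLen m n x) =>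
      (diagRow m n y.1 y.2, diagCol hmn y.1 y.2) := by
  rintro ⟨x, i⟩ ⟨x', i'⟩ h
  rcases x with x | x <;> rcases x' with x' | x' <;>
    simp only [diagRow, diagCol, Prod.mk.injEq, Fin.mk.injEq] at h
  · obtain rfl : x = x' := Fin.ext (by omega)
    obtain rfl : i = i' := Fin.ext (by omega)
    rfl
  · omega
  · omega
  · obtain rfl : x = x' := Fin.ext (by omega)
    obtain rfl : i = i' := Fin.ext (by omega)
    rfl

lemma sum_diagLen_sub (hmn : m ≤ n) {k : ℕ} (hk : k < m) :
    ∑ x, (diagLen m n x - k) = (m - k) * (n - k) := by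
  have hsq : ∀ m, ∑ l ∈ Finset.range m, (l - k) + ∑ l ∈ Finset.range (m + 1), (l - k) =
      (m - k) * (m - k) := by
    intro m
    induction m with
    | zero => simp
    | succ m ih =>
      rw [Finset.sum_range_succ, Finset.sum_range_succ _ (m + 1)]
      rcases le_or_gt k m with h | h
      · obtain ⟨c, rfl⟩ := Nat.exists_eq_add_of_le h
        rw [show k + c + 1 - k = c + 1 by omega, show k + c - k = c by omega] at *
        linarith
      · rw [Nat.sub_eq_zero_of_le h.le] at *
        rw [Nat.sub_eq_zero_of_le (show m + 1 ≤ k by omega)]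
        omega
  rw [Fintype.sum_sum_type]
  simp only [diagLen, Sum.elim_inl, Sum.elim_inr]
  have hsecond : ∑ a : Fin (m - 1), (m - 1 - a - k) = ∑ l ∈ Finset.range m, (l - k) := by
    obtain ⟨m, rfl⟩ : ∃ m', m = m' + 1 := ⟨m - 1, by omega⟩
    rw [Finset.sum_range_succ', Nat.add_sub_cancel, Finset.sum_range fun l => l + 1 - k,
      ← Equiv.sum_comp Fin.revPerm]
    simp only [Nat.zero_sub, add_zero, Fin.revPerm_apply, Fin.val_rev]
    exact Finset.sum_congr rfl fun i _ => by omega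
  have hfirst : ∑ j : Fin n, (min m (n - j) - k) = ∑ l ∈ Finset.range n, (min m (l + 1) - k) := by
    rw [Finset.sum_range fun l => min m (l + 1) - k, ← Equiv.sum_comp Fin.revPerm]
    simp only [Fin.revPerm_apply, Fin.val_rev]
    refine Finset.sum_congr rfl fun i _ => ?_
    congr 2
    omega
  rw [hsecond, hfirst]
  clear hfirst hsecond
  induction n, hmn using Nat.le_induction with
  | base =>
    rw [← hsq m, add_comm, Finset.sum_range_succ' _ m]
    simp only [Nat.zero_sub, add_zero]
    congr 1
    refine Finset.sum_congr rfl fun l hl => ?_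
    rw [min_eq_right (Finset.mem_range.1 hl)]
  | succ n hmn ih =>
    rw [Finset.sum_range_succ, add_right_comm, ih, min_eq_left (by omega),
      show n + 1 - k = n - k + 1 by omega]
    ring

/-- The product of the minors on all diagonals of the generic matrix. -/
noncomputable def diagProd (𝔽 : Type*) [Field 𝔽] (hmn : m ≤ n) :
    MvPolynomial (Fin m × Fin n) 𝔽 :=
  ∏ x, ((genMat 𝔽 m n).submatrix (diagRow m n x) (diagCol hmn x)).det

lemma diagProd_pow_notMem_bracketPow {p : ℕ} (hp : p.Prime) [CharP 𝔽 p] (hmn : m ≤ n) {e N : ℕ}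
    (hN : N < p ^ e) :
    diagProd 𝔽 hmn ^ N ∉ bracketPow (maxIdl 𝔽 (Fin m × Fin n)) (p ^ e) :=
  prod_minors_pow_notMem_bracketPow hp strictMono_diagRow (strictMono_diagCol hmn)
    (injective_diag hmn) hN

lemma diagProd_pow_mem_map (hmn : m ≤ n) (htm : t ≤ m) {V : Type*} [CommRing V] [IsDomain V]
    [ValuationRing V] (φ : MvPolynomial (Fin m × Fin n) 𝔽 →+* V) {r s : ℕ}
    (hrs : ∀ k < t, r * (t - k) ≤ s * ((m - k) * (n - k))) :
    φ (diagProd 𝔽 hmn ^ s) ∈ (minorsIdeal 𝔽 m n t ^ r).map φ := by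
  obtain ⟨w, hw⟩ := exists_minorsOf_eq_span_prod ((genMat 𝔽 m n).map φ)
  have hext : ∀ j ≤ m, ∏ k ∈ Finset.range j, w k ^ (j - k) =
      ∏ k ∈ Finset.range m, w k ^ (j - k) := fun j hj =>
    Finset.prod_subset (Finset.range_subset_range.2 hj) fun k _ hk => by
      rw [Nat.sub_eq_zero_of_le (by simpa using hk), pow_zero]
  rw [Ideal.map_pow, minorsIdeal_eq_minorsOf, map_minorsOf, hw, Ideal.span_singleton_pow,
    Ideal.mem_span_singleton, hext t htm, map_pow]
  have hdvd : ∏ k ∈ Finset.range m, w k ^ ((m - k) * (n - k)) ∣ φ (diagProd 𝔽 hmn) := by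
    rw [diagProd, map_prod]
    calc ∏ k ∈ Finset.range m, w k ^ ((m - k) * (n - k))
        = ∏ k ∈ Finset.range m, ∏ x, w k ^ (diagLen m n x - k) :=
          Finset.prod_congr rfl fun k hk => by
            rw [Finset.prod_pow_eq_pow_sum, sum_diagLen_sub hmn (Finset.mem_range.1 hk)]
      _ = ∏ x, ∏ k ∈ Finset.range m, w k ^ (diagLen m n x - k) := Finset.prod_comm
      _ ∣ _ := Finset.prod_dvd_prod_of_dvd _ _ fun x _ => by
        rw [← hext _ (diagLen_le x), ← Ideal.mem_span_singleton, ← hw, RingHom.map_det]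
        exact Ideal.subset_span ⟨_, _, rfl⟩
  refine Dvd.dvd.trans ?_ (pow_dvd_pow_of_dvd hdvd s)
  rw [← Finset.prod_pow, ← Finset.prod_pow]
  refine Finset.prod_dvd_prod_of_dvd _ _ fun k _ => ?_
  rw [← pow_mul, ← pow_mul]
  refine pow_dvd_pow _ ?_
  rcases lt_or_ge k t with hk | hk
  · have := hrs k hk
    linarith
  · simp [Nat.sub_eq_zero_of_le hk]

lemma exists_diagProd_pow_mem {p : ℕ} (hp : p.Prime) [CharP 𝔽 p] (hmn : m ≤ n) (htm : t ≤ m)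
    {r s : ℕ} (hrs : ∀ k < t, r * (t - k) ≤ s * ((m - k) * (n - k))) :
    ∃ l, ∀ a, diagProd 𝔽 hmn ^ (s * (l + a)) ∈ minorsIdeal 𝔽 m n t ^ (r * a) := by
  have hne : diagProd 𝔽 hmn ≠ 0 := fun h => by
    have hmem := diagProd_pow_notMem_bracketPow (𝔽 := 𝔽) hp hmn (e := 1) (N := 1)
      (by simpa using hp.one_lt)
    rw [h, zero_pow one_ne_zero] at hmem
    exact hmem (Ideal.zero_mem _)
  obtain ⟨l, hl⟩ := exists_pow_add_mem_pow (FractionRing (MvPolynomial (Fin m × Fin n) 𝔽))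
    (minorsIdeal 𝔽 m n t ^ r) (pow_ne_zero s hne)
    fun V φ _ => diagProd_pow_mem_map hmn htm φ hrs
  exact ⟨l, fun a => by rw [pow_mul, pow_mul]; exact hl a⟩

end Lower

/-! ### The `F`-pure threshold -/

section Threshold

variable {p : ℕ} {𝔽 : Type*} [Field 𝔽] [CharP 𝔽 p] {m n t : ℕ}

lemma mul_le_of_not_minorsIdeal_pow_le (hp : p.Prime) (htm : t ≤ m) (hmn : m ≤ n) {k e r : ℕ}
    (hk : k < t)
    (hr : ¬ minorsIdeal 𝔽 m n t ^ r ≤ bracketPow (maxIdl 𝔽 (Fin m × Fin n)) (p ^ e)) :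
    r * (t - k) ≤ (m - k) * (n - k) * p ^ e := by
  by_contra! h
  exact hr (minorsIdeal_pow_le_bracketPow hp (by omega) (by omega) h)

lemma bddAbove_nu (hp : p.Prime) (ht : 0 < t) (htm : t ≤ m) (hmn : m ≤ n) (e : ℕ) :
    BddAbove {r : ℕ | ¬ minorsIdeal 𝔽 m n t ^ r ≤
      bracketPow (maxIdl 𝔽 (Fin m × Fin n)) (p ^ e)} :=
  ⟨m * n * p ^ e, fun r hr => (Nat.le_mul_of_pos_right r ht).trans
    (by simpa using mul_le_of_not_minorsIdeal_pow_le hp htm hmn ht hr)⟩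

lemma nu_minorsIdeal_mul_le (hp : p.Prime) (htm : t ≤ m) (hmn : m ≤ n) {k : ℕ} (hk : k < t)
    (e : ℕ) : nu (minorsIdeal 𝔽 m n t) (p ^ e) * (t - k) ≤ (m - k) * (n - k) * p ^ e := by
  rcases Set.eq_empty_or_nonempty {r : ℕ | ¬ minorsIdeal 𝔽 m n t ^ r ≤
      bracketPow (maxIdl 𝔽 (Fin m × Fin n)) (p ^ e)} with h | h
  · rw [nu, h]
    simp
  · exact mul_le_of_not_minorsIdeal_pow_le hp htm hmn hk
      (Nat.sSup_mem h (bddAbove_nu hp (by omega) htm hmn e))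

/-- Lower bound for `nu`, with an error term independent of `e`. -/
lemma exists_le_nu_minorsIdeal (hp : p.Prime) (ht : 0 < t) (htm : t ≤ m) (hmn : m ≤ n) {r s : ℕ}
    (hs : 0 < s) (hrs : ∀ k < t, r * (t - k) ≤ s * ((m - k) * (n - k))) :
    ∃ c : ℕ, ∀ e, r * p ^ e ≤ s * nu (minorsIdeal 𝔽 m n t) (p ^ e) + c := by
  obtain ⟨l, hl⟩ := exists_diagProd_pow_mem (𝔽 := 𝔽) hp hmn htm hrs
  refine ⟨r * (s * (l + 1)), fun e => ?_⟩
  rcases lt_or_ge (s * l) (p ^ e) with h | h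
  · have hd := Nat.div_add_mod (p ^ e - 1 - s * l) s
    have hmod := Nat.mod_lt (p ^ e - 1 - s * l) hs
    set a := (p ^ e - 1 - s * l) / s
    have hlt : s * (l + a) < p ^ e := by
      rw [mul_add]
      omega
    have hle : r * a ≤ nu (minorsIdeal 𝔽 m n t) (p ^ e) :=
      le_csSup (bddAbove_nu hp ht htm hmn e) fun hle =>
        diagProd_pow_notMem_bracketPow hp hmn hlt (hle (hl a))
    have hpe : p ^ e ≤ s * a + s * (l + 1) := by
      rw [mul_add]
      omega
    calc r * p ^ e ≤ r * (s * a + s * (l + 1)) := Nat.mul_le_mul_left _ hpe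
      _ = s * (r * a) + r * (s * (l + 1)) := by ring
      _ ≤ _ := Nat.add_le_add_right (Nat.mul_le_mul_left _ hle) _
  · refine (Nat.mul_le_mul_left r (h.trans ?_)).trans (Nat.le_add_left _ _)
    exact Nat.mul_le_mul_left _ (Nat.le_succ _)

end Threshold

/-- **Main theorem.**  For `0 < t ≤ m ≤ n` and `X` a generic `m × n` matrix over a field of
prime characteristic `p`, the `F`-pure threshold of the determinantal ideal `I_t`, i.e. the
limit of `ν_{I_t}(p^e)/p^e`, equals `min { (m-k)(n-k)/(t-k) | k = 0, …, t-1 }`. -/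
theorem fpt_determinantal (p : ℕ) (hp : p.Prime) (𝔽 : Type*) [Field 𝔽] [CharP 𝔽 p]
    (m n t : ℕ) (ht : 0 < t) (htm : t ≤ m) (hmn : m ≤ n) :
    Filter.Tendsto (fun e : ℕ => (nu (minorsIdeal 𝔽 m n t) (p ^ e) : ℝ) / (p ^ e : ℕ))
      Filter.atTop
      (nhds (⨅ k : Fin t, (((m - (k : ℕ)) * (n - (k : ℕ)) : ℕ) : ℝ) / ((t - (k : ℕ) : ℕ) : ℝ))) := by
  set c : Fin t → ℝ := fun k =>
    (((m - (k : ℕ)) * (n - (k : ℕ)) : ℕ) : ℝ) / ((t - (k : ℕ) : ℕ) : ℝ) with hc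
  have : Nonempty (Fin t) := ⟨⟨0, ht⟩⟩
  obtain ⟨k₀, hk₀⟩ := exists_eq_ciInf_of_finite (f := c)
  rw [← hk₀]
  have htk : ∀ k : Fin t, (0 : ℝ) < ((t - (k : ℕ) : ℕ) : ℝ) := fun k => by
    exact_mod_cast Nat.sub_pos_of_lt k.2
  have hq : ∀ e : ℕ, (0 : ℝ) < (p ^ e : ℕ) := fun e => by exact_mod_cast pow_pos hp.pos e
  have hrs : ∀ k < t, (m - k₀) * (n - k₀) * (t - k) ≤ (t - k₀) * ((m - k) * (n - k)) := by
    intro k hk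
    have h : c k₀ ≤ c ⟨k, hk⟩ := hk₀ ▸ ciInf_le (Set.finite_range c).bddBelow _
    have h' := (div_le_div_iff₀ (htk k₀) (htk ⟨k, hk⟩)).1 h
    rw [mul_comm (t - (k₀ : ℕ))]
    exact_mod_cast h'
  obtain ⟨d, hd⟩ := exists_le_nu_minorsIdeal (𝔽 := 𝔽) hp ht htm hmn (Nat.sub_pos_of_lt k₀.2) hrs
  have hlim : Filter.Tendsto (fun e : ℕ => c k₀ - d / ((t - (k₀ : ℕ) : ℕ) : ℝ) / (p ^ e : ℕ))
      Filter.atTop (nhds (c k₀)) := by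
    have hpow : Filter.Tendsto (fun e : ℕ => ((p ^ e : ℕ) : ℝ)) Filter.atTop Filter.atTop :=
      tendsto_natCast_atTop_atTop.comp (tendsto_pow_atTop_atTop_of_one_lt hp.one_lt)
    simpa using tendsto_const_nhds.sub (hpow.const_div_atTop (d / ((t - (k₀ : ℕ) : ℕ) : ℝ)))
  refine tendsto_of_tendsto_of_tendsto_of_le_of_le hlim tendsto_const_nhds (fun e => ?_) fun e => ?_
  · have h : (((m - (k₀ : ℕ)) * (n - (k₀ : ℕ)) : ℕ) : ℝ) * (p ^ e : ℕ) ≤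
        ((t - (k₀ : ℕ) : ℕ) : ℝ) * nu (minorsIdeal 𝔽 m n t) (p ^ e) + d := by
      exact_mod_cast hd e
    have hq' := hq e
    have htk' := htk k₀
    simp only [hc]
    rw [le_div_iff₀ hq', sub_mul, div_mul_cancel₀ _ hq'.ne', div_mul_eq_mul_div, ← sub_div,
      div_le_iff₀ htk']
    linarith
  · simp only [hc]
    rw [div_le_div_iff₀ (hq e) (htk k₀)]
    exact_mod_cast nu_minorsIdeal_mul_le (𝔽 := 𝔽) hp htm hmn k₀.2 e
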